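/- arXiv:2401.04466 — 2 statements merged into one kernel-verified Lean document; each statement's English description precedes it below -/
import Mathlib

section
/- Let X be a metric space, I ⊂ ℝ an interval, m < n ∈ ℕ, μ : I^n → ℝ continuous, symmetric, and strictly increasing in each of its variables, and f_1,…,f_m, g_1,…,g_n : X → I be such that (f_1(x),…,f_m(x)) ⊲ (g_1(x),…,g_n(x)) for all x ∈ X. Then the functional equation μ(f_1(x),…,f_m(x), α(x),…,α(x)) = μ(g_1(x),…,g_n(x)) (with α(x) repeated n−m times) has a unique solution α : X → I, and min(g_1,…,g_n) ≤ α ≤ max(g_1,…,g_n) pointwise. -/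
/-- The nondecreasing rearrangement of a vector. -/
noncomputable def sortAsc {n : ℕ} (v : Fin n → ℝ) : Fin n → ℝ :=
  v ∘ Tuple.sort v

/-- The nonincreasing rearrangement of a vector. -/
noncomputable def sortDesc {n : ℕ} (v : Fin n → ℝ) : Fin n → ℝ :=
  fun k => sortAsc v k.rev

/-- `v ∈ ℝ^m` is ordered majorized by `w ∈ ℝ^n` (`m ≤ n`):
`v↓_k ≤ w↓_k` for all `k ∈ {1,…,m}`. -/
def OrdMaj {m n : ℕ} (h : m ≤ n) (v : Fin m → ℝ) (w : Fin n → ℝ) : Prop :=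
  ∀ k : Fin m, sortDesc v k ≤ sortDesc w (Fin.castLE h k)

/-- `v ∈ ℝ^m` is ordered minorized by `w ∈ ℝ^n` (`m ≤ n`):
`v↑_k ≥ w↑_k` for all `k ∈ {1,…,m}`. -/
def OrdMin {m n : ℕ} (h : m ≤ n) (v : Fin m → ℝ) (w : Fin n → ℝ) : Prop :=
  ∀ k : Fin m, sortAsc w (Fin.castLE h k) ≤ sortAsc v k

/-- `v` is embedded in `w`: it is both ordered majorized and ordered minorized by `w`. -/
def Embedded {m n : ℕ} (h : m ≤ n) (v : Fin m → ℝ) (w : Fin n → ℝ) : Prop :=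
  OrdMaj h v w ∧ OrdMin h v w

/-- The vector `(v_1,…,v_m,x,…,x)` of length `n` (`x` repeated `n - m` times). -/
def padRight {m n : ℕ} (v : Fin m → ℝ) (x : ℝ) : Fin n → ℝ :=
  fun i => if h : (i : ℕ) < m then v ⟨i, h⟩ else x

/-- Monotonicity in each variable gives joint monotonicity. -/
lemma aux_mono {n : ℕ} {I : Set ℝ} {μ : (Fin n → ℝ) → ℝ}
    (hmono : ∀ u : Fin n → ℝ, (∀ i, u i ∈ I) → ∀ i : Fin n,
      StrictMonoOn (fun t => μ (Function.update u i t)) I)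
    {u v : Fin n → ℝ} (hu : ∀ i, u i ∈ I) (hv : ∀ i, v i ∈ I) (huv : ∀ i, u i ≤ v i) :
    μ u ≤ μ v := by
  have key : ∀ s : Finset (Fin n), μ u ≤ μ (s.piecewise v u) := by
    intro s
    induction s using Finset.induction_on with
    | empty => simp
    | insert j s hj ih =>
      refine ih.trans ?_
      rw [Finset.piecewise_insert]
      have hp : ∀ i, s.piecewise v u i ∈ I := by
        intro i
        by_cases h : i ∈ s <;> simp [h, hu, hv]
      have h1 := (hmono _ hp j).monotoneOn (hu j) (hv j) (huv j)
      have h2 : Function.update (s.piecewise v u) j (u j) = s.piecewise v u := by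
        rw [Function.update_eq_self_iff]
        simp [hj]
      simp only [h2] at h1
      exact h1
  simpa using key Finset.univ

/-- Strict version. -/
lemma aux_strict {n : ℕ} {I : Set ℝ} {μ : (Fin n → ℝ) → ℝ}
    (hmono : ∀ u : Fin n → ℝ, (∀ i, u i ∈ I) → ∀ i : Fin n,
      StrictMonoOn (fun t => μ (Function.update u i t)) I)
    {u v : Fin n → ℝ} (hu : ∀ i, u i ∈ I) (hv : ∀ i, v i ∈ I) (huv : ∀ i, u i ≤ v i)
    (j : Fin n) (hj : u j < v j) : μ u < μ v := by
  have h1 := hmono u hu j (hu j) (hv j) hj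
  simp only [Function.update_eq_self] at h1
  refine h1.trans_le (aux_mono hmono ?_ hv ?_)
  · intro i
    by_cases h : i = j
    · subst h; simp [hv]
    · simp [h, hu]
  · intro i
    by_cases h : i = j
    · subst h; simp
    · simp [h, huv]

/-- An injection of the first `m` indices extends to a permutation. -/
lemma aux_perm {m n : ℕ} (hmn : m < n) (e : Fin m → Fin n) (he : Function.Injective e) :
    ∃ τ : Equiv.Perm (Fin n), ∀ (i : Fin n) (h : (i : ℕ) < m), τ i = e ⟨i, h⟩ := by
  classical
  let F : Fin n → Fin n := fun i => if h : (i : ℕ) < m then e ⟨i, h⟩ else i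
  have hF : Set.InjOn F {i : Fin n | (i : ℕ) < m} := by
    intro a ha b hb hab
    simp only [Set.mem_setOf_eq] at ha hb
    simp only [F, ha, hb, dif_pos] at hab
    have := he hab
    simp only [Fin.mk.injEq] at this
    exact Fin.ext this
  obtain ⟨τ, hτ⟩ := Set.MapsTo.exists_equiv_extend_of_card_eq (t := Finset.univ)
    (by simp) (f := F) (s := {i : Fin n | (i : ℕ) < m}) (by intro x _; simp) hF
  refine ⟨τ.trans (Equiv.subtypeUnivEquiv (by simp)), ?_⟩
  intro i h
  have := hτ i h
  simp only [F, h, dif_pos] at this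
  simpa using this

lemma aux_pad_mem {m n : ℕ} {I : Set ℝ} {v : Fin m → ℝ} {t : ℝ} (hv : ∀ i, v i ∈ I)
    (ht : t ∈ I) (i : Fin n) : padRight v t i ∈ I := by
  unfold padRight
  split_ifs
  exacts [hv _, ht]

/-- The scalar statement. -/
lemma aux_exists {n m : ℕ} (I : Set ℝ) (hI : I.OrdConnected) (hmn : m < n)
    (μ : (Fin n → ℝ) → ℝ)
    (hcont : ContinuousOn μ {u : Fin n → ℝ | ∀ i, u i ∈ I})
    (hsym : ∀ u : Fin n → ℝ, (∀ i, u i ∈ I) → ∀ σ : Equiv.Perm (Fin n), μ (u ∘ σ) = μ u)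
    (hmono : ∀ u : Fin n → ℝ, (∀ i, u i ∈ I) → ∀ i : Fin n,
      StrictMonoOn (fun t => μ (Function.update u i t)) I)
    (v : Fin m → ℝ) (w : Fin n → ℝ) (hv : ∀ i, v i ∈ I) (hw : ∀ j, w j ∈ I)
    (hvw : Embedded hmn.le v w) :
    ∃ a ∈ I, μ (padRight v a) = μ w ∧ (⨅ j, w j) ≤ a ∧ a ≤ ⨆ j, w j := by
  haveI : Nonempty (Fin n) := ⟨⟨m, hmn⟩⟩
  obtain ⟨j0, h0⟩ := exists_eq_ciInf_of_finite (f := w)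
  obtain ⟨j1, h1⟩ := exists_eq_ciSup_of_finite (f := w)
  have hlo : ∀ j, w j0 ≤ w j := fun j => h0 ▸ ciInf_le (Set.finite_range w).bddBelow j
  have hhi : ∀ j, w j ≤ w j1 := fun j => h1 ▸ le_ciSup (Set.finite_range w).bddAbove j
  rw [← h0, ← h1]
  have hsub : Set.Icc (w j0) (w j1) ⊆ I := hI.out (hw j0) (hw j1)
  obtain ⟨hmaj, hmin⟩ := hvw
  have hup : μ w ≤ μ (padRight v (w j1)) := by
    obtain ⟨τ, hτ⟩ := aux_perm hmn
      (fun i => Tuple.sort w (Fin.castLE hmn.le ((Tuple.sort v).symm i)))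
      ((Tuple.sort w).injective.comp ((Fin.castLE_injective hmn.le).comp
        (Tuple.sort v).symm.injective))
    rw [← hsym w hw τ]
    refine aux_mono hmono (fun i => hw _) (aux_pad_mem hv (hw j1)) ?_
    intro i
    unfold padRight
    split_ifs with h
    · have := hmin ((Tuple.sort v).symm ⟨i, h⟩)
      simp only [sortAsc, Function.comp, Equiv.apply_symm_apply] at this
      simpa [hτ i h] using this
    · exact hhi _
  have hdn : μ (padRight v (w j0)) ≤ μ w := by
    obtain ⟨τ, hτ⟩ := aux_perm hmn
      (fun i => Tuple.sort w (Fin.rev (Fin.castLE hmn.le (Fin.rev ((Tuple.sort v).symm i)))))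
      ((Tuple.sort w).injective.comp (Fin.rev_injective.comp
        ((Fin.castLE_injective hmn.le).comp
        (Fin.rev_injective.comp (Tuple.sort v).symm.injective))))
    rw [← hsym w hw τ]
    refine aux_mono hmono (aux_pad_mem hv (hw j0)) (fun i => hw _) ?_
    intro i
    unfold padRight
    split_ifs with h
    · have := hmaj (Fin.rev ((Tuple.sort v).symm ⟨i, h⟩))
      simp only [sortDesc, sortAsc, Function.comp, Fin.rev_rev, Equiv.apply_symm_apply] at this
      simp only [Function.comp, hτ i h]
      exact this
    · exact hlo _
  have hc : ContinuousOn (fun t => μ (padRight v t)) (Set.Icc (w j0) (w j1)) := by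
    refine hcont.comp (t := {u : Fin n → ℝ | ∀ i, u i ∈ I}) ?_ ?_
    · refine Continuous.continuousOn (continuous_pi fun i => ?_)
      unfold padRight
      split_ifs <;> fun_prop
    · intro t ht
      exact aux_pad_mem hv (hsub ht)
  obtain ⟨a, ha, hae⟩ := intermediate_value_Icc (hlo j1) hc ⟨hdn, hup⟩
  exact ⟨a, hsub ha, hae, ha.1, ha.2⟩

lemma aux_lt {n m : ℕ} (I : Set ℝ) (hmn : m < n) (μ : (Fin n → ℝ) → ℝ)
    (hmono : ∀ u : Fin n → ℝ, (∀ i, u i ∈ I) → ∀ i : Fin n,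
      StrictMonoOn (fun t => μ (Function.update u i t)) I)
    (v : Fin m → ℝ) (hv : ∀ i, v i ∈ I) :
    StrictMonoOn (fun t => μ (padRight v t)) I := by
  intro a ha b hb hab
  refine aux_strict hmono (aux_pad_mem hv ha) (aux_pad_mem hv hb) ?_ ⟨m, hmn⟩ ?_
  · intro i
    unfold padRight
    split_ifs
    exacts [le_rfl, hab.le]
  · simpa [padRight] using hab

/-- Implicit function theorem, existence and uniqueness: if
`(f_1(x),…,f_m(x)) ⊲ (g_1(x),…,g_n(x))` for all `x ∈ X`, then the equation
`μ(f_1(x),…,f_m(x),α(x),…,α(x)) = μ(g_1(x),…,g_n(x))` has a unique solution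
`α : X → I`, and `min(g_1,…,g_n) ≤ α ≤ max(g_1,…,g_n)` pointwise. -/
theorem implicit_function_theorem (X : Type*) [MetricSpace X]
    (I : Set ℝ) (hI : I.OrdConnected) (n m : ℕ) (hmn : m < n)
    (μ : (Fin n → ℝ) → ℝ)
    (hcont : ContinuousOn μ {u : Fin n → ℝ | ∀ i, u i ∈ I})
    (hsym : ∀ u : Fin n → ℝ, (∀ i, u i ∈ I) → ∀ σ : Equiv.Perm (Fin n), μ (u ∘ σ) = μ u)
    (hmono : ∀ u : Fin n → ℝ, (∀ i, u i ∈ I) → ∀ i : Fin n,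
      StrictMonoOn (fun t => μ (Function.update u i t)) I)
    (f : Fin m → X → ℝ) (g : Fin n → X → ℝ)
    (hf : ∀ i x, f i x ∈ I) (hg : ∀ j x, g j x ∈ I)
    (hfg : ∀ x : X, Embedded hmn.le (fun i => f i x) (fun j => g j x)) :
    ∃ α : X → ℝ, ((∀ x, α x ∈ I) ∧
        (∀ x, μ (padRight (fun i => f i x) (α x)) = μ (fun j => g j x)) ∧
        (∀ x, (⨅ j, g j x) ≤ α x ∧ α x ≤ (⨆ j, g j x))) ∧
      ∀ β : X → ℝ, (∀ x, β x ∈ I) →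
        (∀ x, μ (padRight (fun i => f i x) (β x)) = μ (fun j => g j x)) → β = α := by
  choose α hα hμ hlo hhi using fun x => aux_exists I hI hmn μ hcont hsym hmono
    (fun i => f i x) (fun j => g j x) (fun i => hf i x) (fun j => hg j x) (hfg x)
  refine ⟨α, ⟨hα, hμ, fun x => ⟨hlo x, hhi x⟩⟩, ?_⟩
  intro β hβ hβμ
  funext x
  exact (aux_lt I hmn μ hmono (fun i => f i x) (fun i => hf i x)).injOn (hβ x) (hα x)
    ((hβμ x).trans (hμ x).symm)
end

section
/- Let n, k ∈ ℕ, I ⊂ ℝ be an interval, μ : I^n → ℝ continuous, symmetric, and strictly increasing in each variable, M = (M_1,…,M_n) a sequence of symmetric continuous k-variable means on I, and S = (S_1,…,S_m) (m < n) a sequence of symmetric continuous k-variable means on I with (S_1(v),…,S_m(v)) ⊲ (M_1(v),…,M_n(v)) for all v ∈ I^k. Then the function K := 𝒯_{S,M}(μ) : I^k → I, defined so that K(v) is the unique solution x of μ(S_1(v),…,S_m(v), x,…,x) = μ(M_1(v),…,M_n(v)) (with x repeated n−m times), is continuous on I^k. -/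
theorem mu_mono_aux {n : ℕ} {I : Set ℝ} {μ : (Fin n → ℝ) → ℝ}
    (hμmono : ∀ u : Fin n → ℝ, (∀ i, u i ∈ I) → ∀ i : Fin n,
      StrictMonoOn (fun t => μ (Function.update u i t)) I)
    (u w : Fin n → ℝ) (hu : ∀ i, u i ∈ I) (hw : ∀ i, w i ∈ I) (huw : ∀ i, u i ≤ w i) :
    μ u ≤ μ w := by
  classical
  have key : ∀ s : Finset (Fin n), μ u ≤ μ (s.piecewise w u) := by
    intro s
    induction s using Finset.induction_on with
    | empty => simp
    | insert a s ha ih =>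
      refine ih.trans ?_
      rw [Finset.piecewise_insert]
      have hI : ∀ i, s.piecewise w u i ∈ I := by
        intro i
        by_cases h : i ∈ s
        · simpa [h] using hw i
        · simpa [h] using hu i
      have h := (hμmono _ hI a).monotoneOn (hu a) (hw a) (huw a)
      have e : Function.update (s.piecewise w u) a (u a) = s.piecewise w u := by
        rw [Function.update_eq_self_iff]
        simp [ha]
      simpa [e] using h
  simpa using key Finset.univ

theorem mu_strict_aux {n : ℕ} {I : Set ℝ} {μ : (Fin n → ℝ) → ℝ}
    (hμmono : ∀ u : Fin n → ℝ, (∀ i, u i ∈ I) → ∀ i : Fin n,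
      StrictMonoOn (fun t => μ (Function.update u i t)) I)
    (u w : Fin n → ℝ) (hu : ∀ i, u i ∈ I) (hw : ∀ i, w i ∈ I) (huw : ∀ i, u i ≤ w i)
    (a : Fin n) (ha : u a < w a) :
    μ u < μ w := by
  have h := hμmono u hu a (hu a) (hw a) ha
  simp only [Function.update_eq_self] at h
  refine h.trans_le (mu_mono_aux hμmono _ _ ?_ hw ?_)
  · intro i
    by_cases hi : i = a
    · subst hi; simpa using hw i
    · simpa [hi] using hu i
  · intro i
    by_cases hi : i = a
    · subst hi; simp
    · simpa [hi] using huw i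

theorem pad_mem_aux {m n : ℕ} {I : Set ℝ} {s : Fin m → ℝ} {x : ℝ} (hs : ∀ j, s j ∈ I)
    (hx : x ∈ I) (i : Fin n) : (padRight s x : Fin n → ℝ) i ∈ I := by
  unfold padRight
  split_ifs
  · exact hs _
  · exact hx

theorem pad_le_aux {m n : ℕ} {s : Fin m → ℝ} {x y : ℝ} (hxy : x ≤ y) (i : Fin n) :
    (padRight s x : Fin n → ℝ) i ≤ (padRight s y : Fin n → ℝ) i := by
  unfold padRight
  split_ifs
  · exact le_rfl
  · exact hxy

theorem mean_mem_aux {k : ℕ} (hk : 0 < k) {I : Set ℝ} (hI : I.OrdConnected) {v : Fin k → ℝ}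
    (hv : ∀ i, v i ∈ I) {x : ℝ} (hx : (⨅ i, v i) ≤ x ∧ x ≤ ⨆ i, v i) : x ∈ I := by
  haveI : Nonempty (Fin k) := ⟨⟨0, hk⟩⟩
  obtain ⟨i, hi⟩ := exists_eq_ciInf_of_finite (f := v)
  obtain ⟨j, hj⟩ := exists_eq_ciSup_of_finite (f := v)
  rw [← hi, ← hj] at hx
  exact hI.out (hv i) (hv j) hx

/-- for `μ ∈ CS_n(I)`, `M` a sequence of `n` symmetric continuous
`k`-variable means on `I`, and `S ∈ E_m(M)` (`m < n`), the function `K = 𝒯_{S,M}(μ)`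
defined by `μ(S_1(v),…,S_m(v),K(v),…,K(v)) = μ(M_1(v),…,M_n(v))` is continuous on `I^k`. -/
theorem T_continuous (n k m : ℕ) (hk : 0 < k) (hmn : m < n)
    (I : Set ℝ) (hI : I.OrdConnected)
    (μ : (Fin n → ℝ) → ℝ)
    (hμcont : ContinuousOn μ {u : Fin n → ℝ | ∀ i, u i ∈ I})
    (hμsym : ∀ u : Fin n → ℝ, (∀ i, u i ∈ I) → ∀ σ : Equiv.Perm (Fin n), μ (u ∘ σ) = μ u)
    (hμmono : ∀ u : Fin n → ℝ, (∀ i, u i ∈ I) → ∀ i : Fin n,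
      StrictMonoOn (fun t => μ (Function.update u i t)) I)
    (M : Fin n → (Fin k → ℝ) → ℝ)
    (hMmean : ∀ j v, (∀ i, v i ∈ I) → (⨅ i, v i) ≤ M j v ∧ M j v ≤ (⨆ i, v i))
    (hMsym : ∀ j v, (∀ i, v i ∈ I) → ∀ σ : Equiv.Perm (Fin k), M j (v ∘ σ) = M j v)
    (hMcont : ∀ j, ContinuousOn (M j) {v : Fin k → ℝ | ∀ i, v i ∈ I})
    (S : Fin m → (Fin k → ℝ) → ℝ)
    (hSmean : ∀ j v, (∀ i, v i ∈ I) → (⨅ i, v i) ≤ S j v ∧ S j v ≤ (⨆ i, v i))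
    (hSsym : ∀ j v, (∀ i, v i ∈ I) → ∀ σ : Equiv.Perm (Fin k), S j (v ∘ σ) = S j v)
    (hScont : ∀ j, ContinuousOn (S j) {v : Fin k → ℝ | ∀ i, v i ∈ I})
    (hSM : ∀ v : Fin k → ℝ, (∀ i, v i ∈ I) →
      Embedded hmn.le (fun j => S j v) (fun j => M j v))
    (K : (Fin k → ℝ) → ℝ)
    (hK : ∀ v : Fin k → ℝ, (∀ i, v i ∈ I) → K v ∈ I ∧
      μ (padRight (fun j => S j v) (K v)) = μ (fun j => M j v)) :
    ContinuousOn K {v : Fin k → ℝ | ∀ i, v i ∈ I} := by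
  have hSI : ∀ v : Fin k → ℝ, (∀ i, v i ∈ I) → ∀ j, S j v ∈ I := fun v hv j =>
    mean_mem_aux hk hI hv (hSmean j v hv)
  have hMI : ∀ v : Fin k → ℝ, (∀ i, v i ∈ I) → ∀ j, M j v ∈ I := fun v hv j =>
    mean_mem_aux hk hI hv (hMmean j v hv)
  have hg : ContinuousOn (fun v => μ (fun j => M j v)) {v : Fin k → ℝ | ∀ i, v i ∈ I} :=
    hμcont.comp (continuousOn_pi.2 hMcont) (fun v hv => hMI v hv)
  have hf : ∀ a ∈ I, ContinuousOn (fun v => μ (padRight (fun j => S j v) a))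
      {v : Fin k → ℝ | ∀ i, v i ∈ I} := by
    intro a ha
    refine hμcont.comp (continuousOn_pi.2 ?_) (fun v hv => pad_mem_aux (hSI v hv) ha)
    intro i
    unfold padRight
    by_cases h : (i : ℕ) < m
    · simpa [h] using hScont ⟨i, h⟩
    · simpa [h] using continuousOn_const
  have hmono : ∀ v : Fin k → ℝ, (∀ i, v i ∈ I) → ∀ a ∈ I, ∀ b ∈ I, a < b →
      μ (padRight (fun j => S j v) a) < μ (padRight (fun j => S j v) b) := by
    intro v hv a ha b hb hab
    refine mu_strict_aux hμmono _ _ (pad_mem_aux (hSI v hv) ha) (pad_mem_aux (hSI v hv) hb)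
      (pad_le_aux hab.le) ⟨m, hmn⟩ ?_
    simpa [padRight] using hab
  intro v₀ hv₀
  obtain ⟨hK0, hE0⟩ := hK v₀ hv₀
  refine tendsto_order.2 ⟨fun a ha => ?_, fun a ha => ?_⟩
  · by_cases haI : a ∈ I
    · have h1 := hmono v₀ hv₀ a haI _ hK0 ha
      rw [hE0] at h1
      filter_upwards [(hf a haI v₀ hv₀).eventually_lt (hg v₀ hv₀) h1, self_mem_nhdsWithin]
        with v hlt hv
      obtain ⟨hKv, hEv⟩ := hK v hv
      by_contra hcon
      rcases (not_lt.1 hcon).lt_or_eq with h | h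
      · have := hmono v hv _ hKv a haI h
        linarith
      · rw [h] at hEv
        linarith
    · filter_upwards [self_mem_nhdsWithin] with v hv
      by_contra hcon
      exact haI (hI.out (hK v hv).1 hK0 ⟨not_lt.1 hcon, ha.le⟩)
  · by_cases haI : a ∈ I
    · have h1 := hmono v₀ hv₀ _ hK0 a haI ha
      rw [hE0] at h1
      filter_upwards [(hg v₀ hv₀).eventually_lt (hf a haI v₀ hv₀) h1, self_mem_nhdsWithin]
        with v hlt hv
      obtain ⟨hKv, hEv⟩ := hK v hv
      by_contra hcon
      rcases (not_lt.1 hcon).lt_or_eq with h | h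
      · have := hmono v hv a haI _ hKv h
        linarith
      · rw [← h] at hEv
        linarith
    · filter_upwards [self_mem_nhdsWithin] with v hv
      by_contra hcon
      exact haI (hI.out hK0 (hK v hv).1 ⟨ha.le, not_lt.1 hcon⟩)
end
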